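/- Theorem 4.13 (Modal equivalence implies bisimilarity): For arbitrary star-finite pointed simplicial models (𝒞,X) and (𝒞',X'), if (𝒞,X) ≡_{L⁺} (𝒞',X'), then (𝒞,X) ⇄ (𝒞',X') (they are bisimilar). -/

import Mathlib

namespace ISC

/-- Epistemic language `L⁺`: global atoms, local atoms, negation, conjunction,
and the possibility modality `K̂ₐ`. Local atoms are elements of `P`, with
`π : P → A` assigning to each local atom its owner agent. -/
inductive Form (A P : Type) : Type where
  | glob : A → Form A P
  | atom : P → Form A P
  | neg  : Form A P → Form A P
  | conj : Form A P → Form A P → Form A P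
  | know : A → Form A P → Form A P

/-- Formulas of the language `L⁻`, i.e., without global atoms. -/
def Form.NoGlobal {A P : Type} : Form A P → Prop
  | .glob _ => False
  | .atom _ => True
  | .neg φ => φ.NoGlobal
  | .conj φ ψ => φ.NoGlobal ∧ ψ.NoGlobal
  | .know _ φ => φ.NoGlobal

/-- Subformula relation. -/
inductive Form.Subformula {A P : Type} : Form A P → Form A P → Prop where
  | refl (φ : Form A P) : Form.Subformula φ φ
  | neg {ψ φ : Form A P} : Form.Subformula ψ φ → Form.Subformula ψ (.neg φ)
  | conj_left {ψ φ χ : Form A P} : Form.Subformula ψ φ → Form.Subformula ψ (.conj φ χ)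
  | conj_right {ψ φ χ : Form A P} : Form.Subformula ψ χ → Form.Subformula ψ (.conj φ χ)
  | know {ψ φ : Form A P} {a : A} : Form.Subformula ψ φ → Form.Subformula ψ (.know a φ)

/-- A (data of a) simplicial model: a collection of simplexes (sets of vertices),
a chromatic map and a valuation. -/
structure SimpModel (A P : Type) (π : P → A) (V : Type) : Type where
  C : Set (Set V)
  χ : V → A
  ℓ : V → Set P

namespace SimpModel

variable {A P : Type} {π : P → A} {V V' : Type}

/-- The axioms of a simplicial model. -/
def IsWellFormed (M : SimpModel A P π V) : Prop :=
  M.C.Nonempty ∧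
  (∀ X ∈ M.C, X.Finite ∧ X.Nonempty) ∧
  (∀ X ∈ M.C, ∀ Y : Set V, Y.Nonempty → Y ⊆ X → Y ∈ M.C) ∧
  (∀ v : V, {v} ∈ M.C) ∧
  (∀ X ∈ M.C, ∀ u ∈ X, ∀ w ∈ X, M.χ u = M.χ w → u = w) ∧
  (∀ v : V, ∀ p ∈ M.ℓ v, π p = M.χ v)

/-- A facet: a ⊆-maximal simplex. -/
def isFacet (M : SimpModel A P π V) (X : Set V) : Prop :=
  X ∈ M.C ∧ ∀ Y ∈ M.C, X ⊆ Y → X = Y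

/-- `ℓ(X)`, the local atoms of a simplex. -/
def lab (M : SimpModel A P π V) (X : Set V) : Set P := ⋃ v ∈ X, M.ℓ v

/-- Definability `𝒞,X ⋈ φ`. -/
def defined (M : SimpModel A P π V) : Set V → Form A P → Prop
  | _, .glob _ => True
  | X, .atom p => π p ∈ M.χ '' X
  | X, .neg φ => M.defined X φ
  | X, .conj φ ψ => M.defined X φ ∧ M.defined X ψ
  | X, .know a φ => ∃ Y : Set V, M.isFacet Y ∧ a ∈ M.χ '' (X ∩ Y) ∧ M.defined Y φ

/-- Satisfaction `𝒞,X ⊨ φ`. -/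
def sat (M : SimpModel A P π V) : Set V → Form A P → Prop
  | X, .glob a => a ∈ M.χ '' X
  | X, .atom p => p ∈ M.lab X
  | X, .neg φ => M.defined X φ ∧ ¬ M.sat X φ
  | X, .conj φ ψ => M.sat X φ ∧ M.sat X ψ
  | X, .know a φ => ∃ Y : Set V, M.isFacet Y ∧ a ∈ M.χ '' (X ∩ Y) ∧ M.sat Y φ

/-- Star-finiteness: each facet has only finitely many `a`-adjacent facets. -/
def StarFinite (M : SimpModel A P π V) : Prop :=
  ∀ (a : A) (X : Set V), M.isFacet X →
    {Y : Set V | M.isFacet Y ∧ a ∈ M.χ '' (X ∩ Y)}.Finite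

end SimpModel

/-- Modal equivalence of pointed simplicial models in a language `L`. -/
def ModEquiv {A P : Type} {π : P → A} {V V' : Type} (L : Set (Form A P))
    (M : SimpModel A P π V) (X : Set V)
    (M' : SimpModel A P π V') (X' : Set V') : Prop :=
  ∀ φ ∈ L,
    (M.defined X φ ↔ M'.defined X' φ) ∧
    (M.sat X φ ↔ M'.sat X' φ) ∧
    (M.sat X (.neg φ) ↔ M'.sat X' (.neg φ))

/-- `B` is a bisimulation between the simplicial models `M` and `M'`. -/
def IsBisim {A P : Type} {π : P → A} {V V' : Type}
    (M : SimpModel A P π V) (M' : SimpModel A P π V')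
    (B : Set V → Set V' → Prop) : Prop :=
  (∃ X X', B X X') ∧
  (∀ X X', B X X' → M.isFacet X ∧ M'.isFacet X') ∧
  (∀ X X', B X X' →
    (M.χ '' X = M'.χ '' X' ∧ M.lab X = M'.lab X') ∧
    (∀ (a : A) (Y : Set V), M.isFacet Y → a ∈ M.χ '' (X ∩ Y) →
      ∃ Y' : Set V', M'.isFacet Y' ∧ a ∈ M'.χ '' (X' ∩ Y') ∧ B Y Y') ∧
    (∀ (a : A) (Y' : Set V'), M'.isFacet Y' → a ∈ M'.χ '' (X' ∩ Y') →
      ∃ Y : Set V, M.isFacet Y ∧ a ∈ M.χ '' (X ∩ Y) ∧ B Y Y'))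

/-- Bisimilarity of pointed simplicial models. -/
def Bisimilar {A P : Type} {π : P → A} {V V' : Type}
    (M : SimpModel A P π V) (X : Set V)
    (M' : SimpModel A P π V') (X' : Set V') : Prop :=
  ∃ B, IsBisim M M' B ∧ B X X'

/-- Labeled rooted trees: a node carries a set of agents, each edge to a child
carries an agent. -/
inductive LTree (A : Type) : Type where
  | node : Set A → List (A × LTree A) → LTree A

namespace LTree

/-- The label of the root. -/
def label {A : Type} : LTree A → Set A
  | .node s _ => s

/-- The list of children of the root, paired with their edge labels. -/
def children {A : Type} : LTree A → List (A × LTree A)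
  | .node _ cs => cs

/-- The `a`-grafting: add `a` to the root label. -/
def graft {A : Type} (a : A) : LTree A → LTree A
  | .node s cs => .node (insert a s) cs

/-- The life-tree condition: every `a`-edge satisfies `a ∈ L(σ) ∩ L(τ)`. -/
def IsLife {A : Type} : LTree A → Prop
  | .node s cs => ∀ p ∈ cs, p.1 ∈ s ∧ p.1 ∈ p.2.label ∧ p.2.IsLife
  decreasing_by
    rename_i h
    have h2 := List.sizeOf_lt_of_mem h
    obtain ⟨x, y⟩ := p
    simp at h2 ⊢
    omega

end LTree

/-- The life tree `ℒ⟨φ⟩` of a formula. -/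
def Form.lifeTree {A P : Type} (π : P → A) : Form A P → LTree A
  | .glob _ => .node ∅ []
  | .atom p => .node {π p} []
  | .neg φ => φ.lifeTree π
  | .conj φ ψ =>
      .node ((φ.lifeTree π).label ∪ (ψ.lifeTree π).label)
            ((φ.lifeTree π).children ++ (ψ.lifeTree π).children)
  | .know a φ => .node {a} [(a, LTree.graft a (φ.lifeTree π))]

/-- `𝒞,X ⋈ 𝔗`: there is an embedding of the tree `𝔗` into `(𝒞,X)`, i.e., a map
from tree nodes to facets sending the root to `X`, node labels into the colors
of the corresponding facets, and every `a`-edge to a pair of `a`-adjacent facets. -/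
def SimpModel.Embeds {A P : Type} {π : P → A} {V : Type}
    (M : SimpModel A P π V) : Set V → LTree A → Prop
  | X, .node s cs =>
      s ⊆ M.χ '' X ∧
      ∀ p ∈ cs, ∃ Y : Set V, M.isFacet Y ∧ p.1 ∈ M.χ '' (X ∩ Y) ∧ M.Embeds Y p.2
  decreasing_by
    rename_i h
    have h2 := List.sizeOf_lt_of_mem h
    obtain ⟨x, y⟩ := p
    simp at h2 ⊢
    omega

/-- A (data of a) partial epistemic model: a relation for every agent and a
valuation assigning to states sets of global (`Sum.inl`) and local (`Sum.inr`) atoms. -/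
structure PEModel (A P : Type) (π : P → A) (S : Type) : Type where
  rel : A → S → S → Prop
  L : S → Set (A ⊕ P)

namespace PEModel

variable {A P : Type} {π : P → A} {S S' : Type}

/-- The axioms of a partial epistemic model: each `∼ₐ` is a partial equivalence
relation (symmetric and transitive) and proper, local atoms of live agents are
constant on `∼ₐ`-classes, and the global atom `a` holds exactly where `a` is alive. -/
def IsWellFormed (M : PEModel A P π S) : Prop :=
  (∀ (a : A) (s t : S), M.rel a s t → M.rel a t s) ∧
  (∀ (a : A) (s t u : S), M.rel a s t → M.rel a t u → M.rel a s u) ∧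
  (∀ s t : S, s ≠ t → ∃ b : A, M.rel b s s ∧ ¬ M.rel b s t) ∧
  (∀ (a : A) (p : P), π p = a → ∀ s t : S, M.rel a s t →
      (Sum.inr p ∈ M.L s ↔ Sum.inr p ∈ M.L t)) ∧
  (∀ (a : A) (s : S), Sum.inl a ∈ M.L s ↔ M.rel a s s)

/-- Definability `M,s ⋈ φ` on partial epistemic models. -/
def defined (M : PEModel A P π S) : S → Form A P → Prop
  | _, .glob _ => True
  | s, .atom p => M.rel (π p) s s
  | s, .neg φ => M.defined s φ
  | s, .conj φ ψ => M.defined s φ ∧ M.defined s ψ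
  | s, .know a φ => ∃ t : S, M.rel a t s ∧ M.defined t φ

/-- Satisfaction `M,s ⊨ φ` on partial epistemic models. -/
def sat (M : PEModel A P π S) : S → Form A P → Prop
  | s, .glob a => M.rel a s s
  | s, .atom p => M.rel (π p) s s ∧ Sum.inr p ∈ M.L s
  | s, .neg φ => M.defined s φ ∧ ¬ M.sat s φ
  | s, .conj φ ψ => M.sat s φ ∧ M.sat s ψ
  | s, .know a φ => ∃ t : S, M.rel a t s ∧ M.sat t φ

/-- Image-finiteness: every `∼ₐ`-equivalence class is finite. -/
def ImageFinite (M : PEModel A P π S) : Prop :=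
  ∀ (a : A) (s : S), M.rel a s s → {t : S | M.rel a s t}.Finite

/-- The `∼ₐ`-class `[s]ₐ`. -/
def cls (M : PEModel A P π S) (a : A) (s : S) : Set S := {t | M.rel a s t}

/-- Vertices of `σ(M)`: pairs `([s]ₐ, a)` with `a` alive in `s`. -/
def SVtx (M : PEModel A P π S) : Type :=
  {va : Set S × A // ∃ s : S, M.rel va.2 s s ∧ va.1 = M.cls va.2 s}

/-- The set of vertices `{([s]ₐ, a) | a ∈ B}`. -/
def sigmaSet (M : PEModel A P π S) (s : S) (B : Set A) : Set M.SVtx :=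
  {v : M.SVtx | v.val.2 ∈ B ∧ v.val.1 = M.cls v.val.2 s}

/-- The simplicial model `σ(M)` associated with a partial epistemic model. -/
def sigma (M : PEModel A P π S) : SimpModel A P π M.SVtx where
  C := {X : Set M.SVtx |
    ∃ (s : S) (B : Set A), B.Nonempty ∧ (∀ a ∈ B, M.rel a s s) ∧ X = M.sigmaSet s B}
  χ := fun v => v.val.2
  ℓ := fun v => {p : P | π p = v.val.2 ∧ ∃ t ∈ v.val.1, Sum.inr p ∈ M.L t}

/-- The facet `σ(s) = {([s]ₐ, a) | a ∈ Aₛ}`. -/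
def sigmaF (M : PEModel A P π S) (s : S) : Set M.SVtx :=
  M.sigmaSet s {a : A | M.rel a s s}

end PEModel

/-- The partial epistemic model `κ(𝒞)` associated with a simplicial model:
states are the facets, `X ∼ₐ Y` iff `a ∈ χ(X ∩ Y)`, and `L(X) = ℓ(X) ∪ χ(X)`. -/
def SimpModel.kappa {A P : Type} {π : P → A} {V : Type} (M : SimpModel A P π V) :
    PEModel A P π {X : Set V // M.isFacet X} where
  rel := fun a X Y => a ∈ M.χ '' (X.val ∩ Y.val)
  L := fun X => (Sum.inl '' (M.χ '' X.val)) ∪ (Sum.inr '' M.lab X.val)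

/-- `Z` is a life bisimulation between partial epistemic models. -/
def IsLifeBisim {A P : Type} {π : P → A} {S S' : Type}
    (M : PEModel A P π S) (M' : PEModel A P π S') (Z : S → S' → Prop) : Prop :=
  (∃ s s', Z s s') ∧
  ∀ s s', Z s s' →
    ((∀ a : A, Sum.inl a ∈ M.L s ↔ Sum.inl a ∈ M'.L s') ∧
     (∀ a : A, M.rel a s s → ∀ p : P, π p = a →
        (Sum.inr p ∈ M.L s ↔ Sum.inr p ∈ M'.L s'))) ∧
    (∀ a : A, M.rel a s s → ∀ t : S, M.rel a t s →
        ∃ t' : S', M'.rel a t' s' ∧ Z t t') ∧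
    (∀ a : A, M'.rel a s' s' → ∀ t' : S', M'.rel a t' s' →
        ∃ t : S, M.rel a t s ∧ Z t t')

/-- `Z` is a standard bisimulation between partial epistemic models. -/
def IsStdBisim {A P : Type} {π : P → A} {S S' : Type}
    (M : PEModel A P π S) (M' : PEModel A P π S') (Z : S → S' → Prop) : Prop :=
  (∃ s s', Z s s') ∧
  ∀ s s', Z s s' →
    ((∀ a : A, Sum.inl a ∈ M.L s ↔ Sum.inl a ∈ M'.L s') ∧
     (∀ p : P, Sum.inr p ∈ M.L s ↔ Sum.inr p ∈ M'.L s')) ∧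
    (∀ (a : A) (t : S), M.rel a t s → ∃ t' : S', M'.rel a t' s' ∧ Z t t') ∧
    (∀ (a : A) (t' : S'), M'.rel a t' s' → ∃ t : S, M.rel a t s ∧ Z t t')

/-- Modal equivalence of pointed partial epistemic models (in `L⁺`). -/
def ModEquivPar {A P : Type} {π : P → A} {S S' : Type}
    (M : PEModel A P π S) (s : S) (M' : PEModel A P π S') (s' : S') : Prop :=
  ∀ φ : Form A P,
    (M.defined s φ ↔ M'.defined s' φ) ∧
    (M.sat s φ ↔ M'.sat s' φ) ∧
    (M.sat s (.neg φ) ↔ M'.sat s' (.neg φ))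


namespace Form

variable {A P : Type}

/-- A formula satisfied at every simplex. -/
def top (c : A) : Form A P := .neg (.conj (.glob c) (.neg (.glob c)))

/-- The modal depth of a formula, local atoms counting for one. -/
def depth : Form A P → ℕ
  | .glob _ => 0
  | .atom _ => 1
  | .neg φ => φ.depth
  | .conj φ ψ => max φ.depth ψ.depth
  | .know _ φ => φ.depth + 1

/-- The depth-`n` approximation of the definability condition of a formula. -/
def defApprox (π : P → A) (c : A) : Form A P → ℕ → Form A P
  | .glob _, _ => top c
  | .atom _, 0 => top c
  | .atom p, _ + 1 => .glob (π p)
  | .neg φ, n => φ.defApprox π c n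
  | .conj φ ψ, n => .conj (φ.defApprox π c n) (ψ.defApprox π c n)
  | .know _ _, 0 => top c
  | .know a _, 1 => .glob a
  | .know a φ, n + 2 => .know a (φ.defApprox π c (n + 1))

end Form

namespace SimpModel

variable {A P : Type} {π : P → A} {V V' : Type}

lemma defined_top (M : SimpModel A P π V) (c : A) (X : Set V) :
    M.defined X (Form.top c) := by
  simp [Form.top, defined]

lemma sat_top (M : SimpModel A P π V) (c : A) (X : Set V) : M.sat X (Form.top c) := by
  simp [Form.top, defined, sat]

lemma IsWellFormed.defined_of_sat {M : SimpModel A P π V} (hM : M.IsWellFormed)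
    {φ : Form A P} : ∀ {X : Set V}, M.sat X φ → M.defined X φ := by
  induction φ with
  | glob a => intro X _; trivial
  | atom p =>
    intro X h
    simp only [sat, lab, Set.mem_iUnion] at h
    obtain ⟨v, hv, hp⟩ := h
    exact ⟨v, hv, (hM.2.2.2.2.2 v p hp).symm⟩
  | neg φ _ => intro X h; exact h.1
  | conj φ ψ ihφ ihψ => intro X h; exact ⟨ihφ h.1, ihψ h.2⟩
  | know a φ ih =>
    rintro X ⟨Y, hY, ha, h⟩
    exact ⟨Y, hY, ha, ih h⟩

lemma sat_defApprox_zero (M : SimpModel A P π V) (c : A) (φ : Form A P) (X : Set V) :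
    M.sat X (φ.defApprox π c 0) := by
  induction φ with
  | glob a => exact M.sat_top c X
  | atom p => exact M.sat_top c X
  | neg φ ih => exact ih
  | conj φ ψ ihφ ihψ => exact ⟨ihφ, ihψ⟩
  | know a φ _ => exact M.sat_top c X

lemma sat_defApprox_of_defined (M : SimpModel A P π V) (c : A) (φ : Form A P) :
    ∀ (n : ℕ) {X : Set V}, M.defined X φ → M.sat X (φ.defApprox π c n) := by
  induction φ with
  | glob a => intro n X _; exact M.sat_top c X
  | atom p =>
    intro n X h
    cases n with
    | zero => exact M.sat_top c X
    | succ n => exact h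
  | neg φ ih => intro n X h; exact ih n h
  | conj φ ψ ihφ ihψ => intro n X h; exact ⟨ihφ n h.1, ihψ n h.2⟩
  | know a φ ih =>
    rintro n X ⟨Y, hY, ha, h⟩
    match n with
    | 0 => exact M.sat_top c X
    | 1 => exact Set.image_mono Set.inter_subset_left ha
    | n + 2 => exact ⟨Y, hY, ha, ih (n + 1) h⟩

lemma defined_defApprox_succ (M : SimpModel A P π V) (c : A) (φ : Form A P) :
    ∀ (n : ℕ) {X : Set V}, M.isFacet X → M.sat X (φ.defApprox π c n) →
      M.defined X (φ.defApprox π c (n + 1)) := by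
  induction φ with
  | glob a => intro n X _ _; exact M.defined_top c X
  | atom p => intro n X _ _; trivial
  | neg φ ih => intro n X hX h; exact ih n hX h
  | conj φ ψ ihφ ihψ => intro n X hX h; exact ⟨ihφ n hX h.1, ihψ n hX h.2⟩
  | know a φ ih =>
    intro n X hX h
    match n with
    | 0 => trivial
    | 1 =>
      exact ⟨X, hX, (Set.inter_self X).symm ▸ h, ih 0 hX (M.sat_defApprox_zero c φ X)⟩
    | n + 2 =>
      obtain ⟨Y, hY, ha, h⟩ := h
      exact ⟨Y, hY, ha, ih (n + 1) hY h⟩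

lemma defined_of_sat_defApprox (M : SimpModel A P π V) (c : A) (φ : Form A P) :
    ∀ {n : ℕ} {X : Set V}, φ.depth < n → M.sat X (φ.defApprox π c n) → M.defined X φ := by
  induction φ with
  | glob a => intro n X _ _; trivial
  | atom p =>
    intro n X hn h
    cases n with
    | zero => exact absurd hn (Nat.not_lt_zero _)
    | succ n => exact h
  | neg φ ih => intro n X hn h; exact ih hn h
  | conj φ ψ ihφ ihψ =>
    intro n X hn h
    exact ⟨ihφ ((le_max_left _ _).trans_lt hn) h.1, ihψ ((le_max_right _ _).trans_lt hn) h.2⟩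
  | know a φ ih =>
    intro n X hn h
    match n with
    | 0 => exact absurd hn (Nat.not_lt_zero _)
    | 1 => simp [Form.depth] at hn
    | n + 2 =>
      obtain ⟨Y, hY, ha, h⟩ := h
      exact ⟨Y, hY, ha, ih (Nat.lt_of_succ_lt_succ hn) h⟩

/-- Definability is reflected by inclusion of theories. -/
lemma defined_of_sat_imp {M : SimpModel A P π V} {M' : SimpModel A P π V'} (c : A)
    {X : Set V} {X' : Set V'} (hX : M.isFacet X)
    (h : ∀ φ, M.sat X φ → M'.sat X' φ) {φ : Form A P} (hφ : M'.defined X' φ) :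
    M.defined X φ := by
  have key (n : ℕ) : M.sat X (φ.defApprox π c n) := by
    induction n with
    | zero => exact M.sat_defApprox_zero c φ X
    | succ n ih =>
      by_contra hn
      exact (h (.neg _) ⟨M.defined_defApprox_succ c φ n hX ih, hn⟩).2
        (M'.sat_defApprox_of_defined c φ _ hφ)
  exact M.defined_of_sat_defApprox c φ (Nat.lt_succ_self _) (key _)

/-- Inclusion of theories at facets already yields modal equivalence. -/
lemma modEquiv_of_sat_imp {M : SimpModel A P π V} {M' : SimpModel A P π V'} (c : A)
    (hM' : M'.IsWellFormed) {X : Set V} {X' : Set V'} (hX : M.isFacet X)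
    (h : ∀ φ, M.sat X φ → M'.sat X' φ) (L : Set (Form A P)) : ModEquiv L M X M' X' := by
  have hdef (φ : Form A P) : M.defined X φ ↔ M'.defined X' φ := by
    refine ⟨fun hφ => ?_, defined_of_sat_imp c hX h⟩
    by_cases hs : M.sat X φ
    · exact hM'.defined_of_sat (h φ hs)
    · exact (h (.neg φ) ⟨hφ, hs⟩).1
  have hsat (φ : Form A P) : M.sat X φ ↔ M'.sat X' φ := by
    refine ⟨h φ, fun hφ => ?_⟩
    by_contra hn
    exact (h (.neg φ) ⟨(hdef φ).2 (hM'.defined_of_sat hφ), hn⟩).2 hφ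
  exact fun φ _ => ⟨hdef φ, hsat φ, hsat (.neg φ)⟩

/-- Finitely many simplexes can be separated simultaneously by a conjunction. -/
lemma exists_sat_forall_not_sat {M : SimpModel A P π V} {M' : SimpModel A P π V'} (c : A)
    {Y : Set V} {S : Set (Set V')} (hS : S.Finite)
    (h : ∀ Y' ∈ S, ∃ φ, M.sat Y φ ∧ ¬ M'.sat Y' φ) :
    ∃ φ, M.sat Y φ ∧ ∀ Y' ∈ S, ¬ M'.sat Y' φ := by
  induction S, hS using Set.Finite.induction_on with
  | empty => exact ⟨Form.top c, M.sat_top c Y, by simp⟩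
  | @insert Z S _ _ ih =>
    obtain ⟨φ, hφ, hφS⟩ := ih fun Y' hY' => h Y' (Set.mem_insert_of_mem _ hY')
    obtain ⟨ψ, hψ, hψZ⟩ := h Z (Set.mem_insert _ _)
    refine ⟨.conj φ ψ, ⟨hφ, hψ⟩, ?_⟩
    rintro Y' (rfl | hY') hs
    · exact hψZ hs.2
    · exact hφS Y' hY' hs.1

/-- Modal equivalence satisfies the forth condition over a star-finite model. -/
lemma exists_adjacent_modEquiv {M : SimpModel A P π V} {M' : SimpModel A P π V'}
    (hM' : M'.IsWellFormed) (hSF' : M'.StarFinite)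
    {X : Set V} {X' : Set V'} (hX' : M'.isFacet X') (h : ModEquiv Set.univ M X M' X')
    {a : A} {Y : Set V} (hY : M.isFacet Y) (ha : a ∈ M.χ '' (X ∩ Y)) :
    ∃ Y' : Set V', M'.isFacet Y' ∧ a ∈ M'.χ '' (X' ∩ Y') ∧
      ModEquiv Set.univ M Y M' Y' := by
  by_contra! hne
  obtain ⟨φ, hφ, hφS⟩ := exists_sat_forall_not_sat (M := M) (M' := M') (Y := Y) a
    (hSF' a X' hX') (by
      rintro Y' ⟨hY', ha'⟩
      by_contra! hsub
      exact hne Y' hY' ha' (modEquiv_of_sat_imp a hM' hY hsub _))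
  obtain ⟨Y', hY', ha', hs⟩ := (h (.know a φ) (Set.mem_univ _)).2.1.1 ⟨Y, hY, ha, hφ⟩
  exact hφS Y' ⟨hY', ha'⟩ hs

end SimpModel

lemma ModEquiv.symm {A P : Type} {π : P → A} {V V' : Type} {L : Set (Form A P)}
    {M : SimpModel A P π V} {X : Set V} {M' : SimpModel A P π V'} {X' : Set V'}
    (h : ModEquiv L M X M' X') : ModEquiv L M' X' M X :=
  fun φ hφ => ⟨(h φ hφ).1.symm, (h φ hφ).2.1.symm, (h φ hφ).2.2.symm⟩

/-- **Theorem 4.13 (Modal equivalence implies bisimilarity).** For arbitrary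
star-finite pointed simplicial models, `(𝒞,X) ≡_{L⁺} (𝒞',X')` implies
`(𝒞,X) ⇄ (𝒞',X')`. -/
theorem modal_equivalence_implies_bisimilarity
    {A P V V' : Type} [Fintype A] [Countable P] {π : P → A}
    (M : SimpModel A P π V) (M' : SimpModel A P π V')
    (hM : M.IsWellFormed) (hM' : M'.IsWellFormed)
    (hSF : M.StarFinite) (hSF' : M'.StarFinite)
    (X : Set V) (X' : Set V') (hX : M.isFacet X) (hX' : M'.isFacet X')
    (h : ModEquiv Set.univ M X M' X') :
    Bisimilar M X M' X' := by
  refine ⟨fun Y Y' => M.isFacet Y ∧ M'.isFacet Y' ∧ ModEquiv Set.univ M Y M' Y',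
    ⟨⟨X, X', hX, hX', h⟩, fun _ _ hB => ⟨hB.1, hB.2.1⟩, ?_⟩, hX, hX', h⟩
  rintro X X' ⟨hX, hX', h⟩
  refine ⟨⟨?_, ?_⟩, fun a Y hY ha => ?_, fun a Y' hY' ha => ?_⟩
  · ext a
    exact (h (.glob a) (Set.mem_univ _)).2.1
  · ext p
    exact (h (.atom p) (Set.mem_univ _)).2.1
  · obtain ⟨Y', hY', ha', hE⟩ := SimpModel.exists_adjacent_modEquiv hM' hSF' hX' h hY ha
    exact ⟨Y', hY', ha', hY, hY', hE⟩
  · obtain ⟨Y, hY, ha', hE⟩ := SimpModel.exists_adjacent_modEquiv hM hSF hX h.symm hY' ha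
    exact ⟨Y, hY, ha', hY, hY', hE.symm⟩

end ISC
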